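/- Let T̲ : ℝ^𝒳 → ℝ^𝒳 be a coherent map satisfying the reachability condition (R1), with dual representation 𝒯, and let {hₙ} be a sequence in ℝ^𝒳 constructed as follows: for each n ≥ 1, Tₙ is an extreme point of 𝒯, hₙ is the unique solution in ℝ^𝒳 of hₙ = 𝟙_{Aᶜ} + 𝟙_{Aᶜ}·(Tₙhₙ), and T̲hₙ = T_{n+1}hₙ. Then either the sequence {hₙ} is strictly decreasing everywhere (h_{n+1} ≤ hₙ and h_{n+1} ≠ hₙ for all n), or there is some m ≥ 1 such that h_{n+1} ≤ hₙ with h_{n+1} ≠ hₙ for all n < m, and hₖ = h_* for all k ≥ m, where h_* := lim_{n→∞} hₙ. -/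

import Mathlib

open Function Set Filter Topology

/-- A map `T : ℝ^𝒳 → ℝ^𝒳` is *coherent* if it is non-negatively homogeneous (C1),
super-additive (C2), and dominates the pointwise minimum (C3). -/
def Coherent {X : Type*} [Fintype X] [Nonempty X] (T : (X → ℝ) → (X → ℝ)) : Prop :=
  (∀ (α : ℝ), 0 ≤ α → ∀ f, T (α • f) = α • T f) ∧
  (∀ f g, T f + T g ≤ T (f + g)) ∧
  (∀ (f : X → ℝ) (x : X), (⨅ y, f y) ≤ T f x)

/-- The reachability condition (R1) with respect to the target set `A`. -/
def Reach {X : Type*} (A : Set X) (T : (X → ℝ) → (X → ℝ)) : Prop :=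
  ∀ x ∈ Aᶜ, ∃ n : ℕ, 0 < n ∧ 0 < T^[n] (A.indicator 1) x

/-- The dual representation of `Tl`: the set of all linear coherent maps that dominate `Tl`. -/
def DualRep {X : Type*} [Fintype X] [Nonempty X] (Tl : (X → ℝ) → (X → ℝ)) :
    Set ((X → ℝ) → (X → ℝ)) :=
  {T | IsLinearMap ℝ T ∧ Coherent T ∧ ∀ f, Tl f ≤ T f}

theorem Coherent.nonneg {X : Type*} [Fintype X] [Nonempty X] {T : (X → ℝ) → (X → ℝ)}
    (hT : Coherent T) {f : X → ℝ} (hf : 0 ≤ f) : 0 ≤ T f := fun x =>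
  (le_ciInf (fun y => hf y)).trans (hT.2.2 f x)

theorem Coherent.monotone {X : Type*} [Fintype X] [Nonempty X] {T : (X → ℝ) → (X → ℝ)}
    (hT : Coherent T) : Monotone T := by
  intro f g hfg
  have h₁ := hT.2.1 f (g - f)
  rw [add_sub_cancel] at h₁
  exact (le_add_of_nonneg_right (hT.nonneg (sub_nonneg.2 hfg))).trans h₁

/-- A nonnegative function vanishing at the zeros of a nonnegative `g` on a finite type is bounded
by a multiple of `g`. -/
theorem exists_nonneg_le_smul_of_eq_zero {X : Type*} [Fintype X] {f g : X → ℝ}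
    (hf : 0 ≤ f) (hg : 0 ≤ g) (hfg : ∀ x, g x = 0 → f x = 0) :
    ∃ K : ℝ, 0 ≤ K ∧ f ≤ K • g := by
  have hpos : ∀ y ∈ Finset.univ, 0 ≤ f y / g y := fun y _ => div_nonneg (hf y) (hg y)
  refine ⟨∑ y, f y / g y, Finset.sum_nonneg hpos, fun x => ?_⟩
  calc f x = f x / g x * g x := (div_mul_cancel_of_imp (hfg x)).symm
    _ ≤ (∑ y, f y / g y) * g x :=
      mul_le_mul_of_nonneg_right (Finset.single_le_sum hpos (Finset.mem_univ x)) (hg x)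

/-- Minimum principle: if `A` is reachable for the lower map `Tl`, then a function that is
nonnegative on `A` and superharmonic off `A` for some member of the dual representation is
nonnegative. -/
theorem nonneg_of_mem_dualRep {X : Type*} [Fintype X] [Nonempty X] {A : Set X}
    {Tl T : (X → ℝ) → (X → ℝ)} (hTl : Coherent Tl) (hR : Reach A Tl) (hT : T ∈ DualRep Tl)
    {d : X → ℝ} (hdA : ∀ x ∈ A, 0 ≤ d x) (hd : ∀ x ∈ Aᶜ, T d x ≤ d x) : 0 ≤ d := by
  obtain ⟨hlin, hcoh, hdom⟩ := hT
  obtain ⟨x₀, hx₀⟩ := Finite.exists_min d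
  by_contra hneg
  have hm : d x₀ < 0 := by
    by_contra! hm
    exact hneg fun x => hm.trans (hx₀ x)
  have hMA : ∀ x, d x = d x₀ → x ∈ Aᶜ := fun x hx hxA => by
    have := hdA x hxA
    linarith
  set c : X → ℝ := fun _ => d x₀ with hc
  have hg : 0 ≤ d - c := fun x => sub_nonneg.2 (hx₀ x)
  have hTg : ∀ x, d x = d x₀ → T (d - c) x ≤ 0 := by
    intro x hx
    have h₁ : d x₀ ≤ T c x := by simpa [hc] using hcoh.2.2 c x
    have h₂ := hd x (hMA x hx)
    rw [hlin.map_sub]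
    simp only [Pi.sub_apply]
    linarith
  have key : ∀ n : ℕ, 0 ≤ Tl^[n] (A.indicator 1) ∧
      ∀ x, d x = d x₀ → Tl^[n] (A.indicator 1) x = 0 := by
    intro n
    induction n with
    | zero =>
      exact ⟨Set.indicator_nonneg fun _ _ => zero_le_one,
        fun x hx => Set.indicator_of_notMem (hMA x hx) _⟩
    | succ n ih =>
      rw [Function.iterate_succ_apply']
      obtain ⟨hf, hf₀⟩ := ih
      refine ⟨hTl.nonneg hf, fun x hx => le_antisymm ?_ (hTl.nonneg hf x)⟩
      obtain ⟨K, hK, hfK⟩ := exists_nonneg_le_smul_of_eq_zero hf hg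
        fun y hy => hf₀ y (sub_eq_zero.1 hy)
      calc Tl (Tl^[n] (A.indicator 1)) x ≤ T (Tl^[n] (A.indicator 1)) x := hdom _ x
        _ ≤ T (K • (d - c)) x := hcoh.monotone hfK x
        _ = K * T (d - c) x := by rw [hlin.map_smul]; rfl
        _ ≤ 0 := mul_nonpos_of_nonneg_of_nonpos hK (hTg x hx)
  obtain ⟨n, -, hn⟩ := hR x₀ (hMA x₀ rfl)
  exact hn.ne' ((key n).2 x₀ rfl)

/-- Comparison principle for the hitting-time equation of a member of the dual representation. -/
theorem le_of_hitting_equation {X : Type*} [Fintype X] [Nonempty X] {A : Set X}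
    {Tl T : (X → ℝ) → (X → ℝ)} (hTl : Coherent Tl) (hR : Reach A Tl) (hT : T ∈ DualRep Tl)
    {u v : X → ℝ}
    (hu : u ≤ (Aᶜ : Set X).indicator 1 + (Aᶜ : Set X).indicator 1 * T u)
    (hv : (Aᶜ : Set X).indicator 1 + (Aᶜ : Set X).indicator 1 * T v ≤ v) : u ≤ v := by
  refine sub_nonneg.1 (nonneg_of_mem_dualRep hTl hR hT (fun x hx => ?_) fun x hx => ?_)
  all_goals
    have hux := hu x
    have hvx := hv x
  · simp only [Pi.add_apply, Pi.mul_apply, Set.indicator_of_notMem (Set.notMem_compl_iff.2 hx)]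
      at hux hvx
    simp only [Pi.sub_apply]
    linarith
  · simp only [Pi.add_apply, Pi.mul_apply, Set.indicator_of_mem hx, Pi.one_apply] at hux hvx
    rw [hT.1.map_sub]
    simp only [Pi.sub_apply]
    linarith

theorem stmt18 {X : Type*} [Fintype X] [Nonempty X] (A : Set X)
    (hA : A.Nonempty) (hAc : (Aᶜ : Set X).Nonempty)
    (Tl : (X → ℝ) → (X → ℝ)) (hTl : Coherent Tl) (hR : Reach A Tl)
    (T : ℕ → (X → ℝ) → (X → ℝ)) (h : ℕ → X → ℝ)
    (hext : ∀ n : ℕ, 1 ≤ n → T n ∈ Set.extremePoints ℝ (DualRep Tl))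
    (hsol : ∀ n : ℕ, 1 ≤ n →
      h n = (Aᶜ : Set X).indicator 1 + (Aᶜ : Set X).indicator 1 * T n (h n))
    (hnext : ∀ n : ℕ, 1 ≤ n → Tl (h n) = T (n + 1) (h n)) :
    (∀ n : ℕ, 1 ≤ n → h (n + 1) ≤ h n ∧ h (n + 1) ≠ h n) ∨
    ∃ m : ℕ, 1 ≤ m ∧
      (∀ n : ℕ, 1 ≤ n → n < m → h (n + 1) ≤ h n ∧ h (n + 1) ≠ h n) ∧
      ∃ hstar : X → ℝ, Tendsto h atTop (𝓝 hstar) ∧ ∀ k : ℕ, m ≤ k → h k = hstar := by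
  have hmem : ∀ n, 1 ≤ n → T n ∈ DualRep Tl := fun n hn => (hext n hn).1
  have hanti : ∀ n, 1 ≤ n → h (n + 1) ≤ h n := by
    intro n hn
    refine le_of_hitting_equation hTl hR (hmem (n + 1) (by omega)) (hsol (n + 1) (by omega)).le ?_
    rw [← hnext n hn]
    conv_rhs => rw [hsol n hn]
    exact add_le_add_right (mul_le_mul_of_nonneg_left ((hmem n hn).2.2 _)
      (Set.indicator_nonneg fun _ _ => zero_le_one)) _
  have hstep : ∀ n, 1 ≤ n → h (n + 1) = h n → h (n + 2) = h (n + 1) := by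
    intro n hn heq
    refine le_antisymm (hanti (n + 1) (by omega)) ?_
    refine le_of_hitting_equation hTl hR (hmem (n + 2) (by omega)) ?_ (hsol (n + 2) (by omega)).ge
    rw [← hnext (n + 1) (by omega), heq, hnext n hn]
    conv_lhs => rw [← heq, hsol (n + 1) (by omega), heq]
  classical
  by_cases hex : ∃ n, 1 ≤ n ∧ h (n + 1) = h n
  · right
    obtain ⟨hm, hmeq⟩ := Nat.find_spec hex
    have hconst : ∀ k, Nat.find hex ≤ k → h (k + 1) = h k := fun k hk =>
      Nat.le_induction hmeq (fun j hj ih => hstep j (hm.trans hj) ih) k hk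
    have hstat : ∀ k, Nat.find hex ≤ k → h k = h (Nat.find hex) := fun k hk =>
      Nat.le_induction rfl (fun j hj ih => (hconst j hj).trans ih) k hk
    refine ⟨Nat.find hex, hm, fun n hn hlt =>
      ⟨hanti n hn, fun heq => Nat.find_min hex hlt ⟨hn, heq⟩⟩, h (Nat.find hex), ?_, hstat⟩
    exact tendsto_atTop_of_eventually_const hstat
  · left
    exact fun n hn => ⟨hanti n hn, fun heq => hex ⟨n, hn, heq⟩⟩
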